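/- Monotonicity of thresholds (Proposition 4): let r be an equilibrium threshold profile. Then for any two distinct agents i and j, r_i < r_j if and only if p_i^lom < p_j^lom (and consequently r_i = r_j if and only if p_i^lom = p_j^lom). -/

import Mathlib

open Finset

/-- `x` leads `y` (with requester `p`): `x ≠ y` and every walk from `p` to `y` contains `x`
in its support. -/
def Leads {V : Type*} (H : SimpleGraph V) (p x y : V) : Prop :=
  x ≠ y ∧ ∀ w : H.Walk p y, x ∈ w.support

variable {V : Type*} [Fintype V] [DecidableEq V]

/-- The agents: all vertices other than the requester `p`. -/
def agents (p : V) : Finset V := Finset.univ.filter (· ≠ p)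

/-- `Dset H p i`: the set of agents led by `i`. -/
noncomputable def Dset (H : SimpleGraph V) (p i : V) : Finset V :=
  @Finset.filter _ (fun j => Leads H p i j) (Classical.decPred _) (agents p)

/-- `Pset H p i`: the competitors of `i`, namely `U \ (D_i ∪ {i})`. -/
noncomputable def Pset (H : SimpleGraph V) (p i : V) : Finset V :=
  agents p \ insert i (Dset H p i)

/-- Agent `i`'s expected utility for contributing with ability `q`:
`π_i(q) = M * ∏_{j ∈ P_i} F (max (r j) q) - c`. -/
noncomputable def piU (H : SimpleGraph V) (p : V) (c M : ℝ) (F : ℝ → ℝ)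
    (r : V → ℝ) (i : V) (q : ℝ) : ℝ :=
  M * (∏ j ∈ Pset H p i, F (max (r j) q)) - c

/-- `r` is an equilibrium threshold profile: every threshold lies in `[l,u]`, every agent has
strictly positive utility for contributing with any ability strictly above her threshold, and
each threshold is either `l` or gives nonpositive utility. -/
def IsEqm (H : SimpleGraph V) (p : V) (l u c M : ℝ) (F : ℝ → ℝ) (r : V → ℝ) : Prop :=
  (∀ i ∈ agents p, r i ∈ Set.Icc l u) ∧
  (∀ i ∈ agents p, ∀ q ∈ Set.Ioc (r i) u, 0 < piU H p c M F r i q) ∧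
  (∀ i ∈ agents p, r i = l ∨ piU H p c M F r i (r i) ≤ 0)

/-- The leader-of-mediocre probability `p_i^lom = ∏_{k ∈ D_i} F (r k)`. -/
noncomputable def lom (H : SimpleGraph V) (p : V) (F : ℝ → ℝ) (r : V → ℝ) (i : V) : ℝ :=
  ∏ k ∈ Dset H p i, F (r k)

theorem Leads.trans {V : Type*} [DecidableEq V] {H : SimpleGraph V} {p x y z : V}
    (hxy : Leads H p x y) (hyz : Leads H p y z) (hxz : x ≠ z) : Leads H p x z :=
  ⟨hxz, fun w => w.support_takeUntil_subset_support (hyz.2 w)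
    (hxy.2 (w.takeUntil y (hyz.2 w)))⟩

theorem Leads.asymm {V : Type*} [DecidableEq V] {H : SimpleGraph V} {p x y : V}
    (hreach : ∀ v : V, Nonempty (H.Walk p v)) (hxy : Leads H p x y) : ¬ Leads H p y x := by
  intro hyx
  obtain ⟨w, hw⟩ := SimpleGraph.Reachable.exists_walk_length_eq_dist (hreach y)
  have h₁ := SimpleGraph.Walk.length_takeUntil_lt_length (hxy.2 w) hxy.1
  have h₂ := SimpleGraph.Walk.length_takeUntil_lt_length (hyx.2 (w.takeUntil x (hxy.2 w))) hyx.1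
  have h₃ := SimpleGraph.dist_le ((w.takeUntil x (hxy.2 w)).takeUntil y (hyx.2 _))
  omega

section Agents

variable {H : SimpleGraph V} {p : V}

theorem mem_Dset {i j : V} : j ∈ Dset H p i ↔ j ∈ agents p ∧ Leads H p i j := by
  simp [Dset]

theorem mem_Pset {i j : V} :
    j ∈ Pset H p i ↔ j ∈ agents p ∧ j ≠ i ∧ ¬ Leads H p i j := by
  simp only [Pset, mem_sdiff, mem_insert, mem_Dset]
  tauto

/-- An agent led by `i` competes with `i` and with all competitors of `i`. -/
theorem insert_Pset_subset (hreach : ∀ v : V, Nonempty (H.Walk p v)) {i k : V}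
    (hi : i ∈ agents p) (hik : Leads H p i k) : insert i (Pset H p i) ⊆ Pset H p k := by
  intro x hx
  rw [mem_insert, mem_Pset] at hx
  rw [mem_Pset]
  rcases hx with rfl | ⟨hx, hxi, hlead⟩
  · exact ⟨hi, hik.1, hik.asymm hreach⟩
  · exact ⟨hx, fun h => hlead (h ▸ hik), fun h => hlead (hik.trans h hxi.symm)⟩

theorem prod_agents_eq (f : V → ℝ) {i : V} (hi : i ∈ agents p) :
    ∏ k ∈ agents p, f k = (∏ k ∈ Pset H p i, f k) * (f i * ∏ k ∈ Dset H p i, f k) := by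
  have hnot : i ∉ Dset H p i := fun h => (mem_Dset.1 h).2.1 rfl
  have hsub : insert i (Dset H p i) ⊆ agents p := by
    intro x hx
    rcases mem_insert.1 hx with rfl | hx
    · exact hi
    · exact (mem_Dset.1 hx).1
  rw [← prod_insert hnot, Pset, prod_sdiff hsub]

end Agents

section Equilibrium

variable {H : SimpleGraph V} {p : V}
  {l u c M : ℝ} {F : ℝ → ℝ} {r : V → ℝ}

theorem IsEqm.lt_upper (heqm : IsEqm H p l u c M F r) (hlu : l < u) (hcM : c < M)
    (hFu : F u = 1) {i : V} (hi : i ∈ agents p) : r i < u := by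
  refine lt_of_le_of_ne (heqm.1 i hi).2 fun hiu => ?_
  rcases heqm.2.2 i hi with h | h
  · linarith
  · have hone : ∏ j ∈ Pset H p i, F (max (r j) u) = 1 := prod_eq_one fun j hj => by
      rw [max_eq_right (heqm.1 j (mem_Pset.1 hj).1).2, hFu]
    rw [hiu, piU, hone] at h
    linarith

theorem IsEqm.continuousOn_piU (heqm : IsEqm H p l u c M F r)
    (hFcont : ContinuousOn F (Set.Icc l u)) (i : V) :
    ContinuousOn (piU H p c M F r i) (Set.Icc l u) := by
  unfold piU
  refine (continuousOn_const.mul (continuousOn_finsetProd _ fun j hj => ?_)).sub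
    continuousOn_const
  refine hFcont.comp (by fun_prop) fun q hq => ?_
  have hj := heqm.1 j (mem_Pset.1 hj).1
  exact ⟨hq.1.trans (le_max_right _ _), max_le hj.2 hq.2⟩

theorem IsEqm.piU_nonneg (heqm : IsEqm H p l u c M F r) (hlu : l < u) (hcM : c < M)
    (hFcont : ContinuousOn F (Set.Icc l u)) (hFu : F u = 1) {i : V} (hi : i ∈ agents p)
    {q : ℝ} (hq : q ∈ Set.Icc (r i) u) : 0 ≤ piU H p c M F r i q := by
  have hcl := closure_Ioc (heqm.lt_upper hlu hcM hFu hi).ne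
  refine le_on_closure (s := Set.Ioc (r i) u) (f := fun _ => (0 : ℝ))
    (fun x hx => (heqm.2.1 i hi x hx).le) continuousOn_const ?_ (hcl ▸ hq)
  rw [hcl]
  exact (heqm.continuousOn_piU hFcont i).mono (Set.Icc_subset_Icc_left (heqm.1 i hi).1)

theorem IsEqm.map_max_mem_Icc (heqm : IsEqm H p l u c M F r)
    (hFmono : StrictMonoOn F (Set.Icc l u)) (hlu : l < u) (hFl : F l = 0) (hFu : F u = 1)
    {k : V} (hk : k ∈ agents p) {q : ℝ} (hq : q ∈ Set.Icc l u) :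
    F (max (r k) q) ∈ Set.Icc 0 1 := by
  have hmem : max (r k) q ∈ Set.Icc l u :=
    ⟨hq.1.trans (le_max_right _ _), max_le (heqm.1 k hk).2 hq.2⟩
  rw [← hFl, ← hFu]
  exact ⟨hFmono.monotoneOn (Set.left_mem_Icc.2 hlu.le) hmem hmem.1,
    hFmono.monotoneOn hmem (Set.right_mem_Icc.2 hlu.le) hmem.2⟩

/-- A leader has a strictly lower threshold than the agents she leads. -/
theorem IsEqm.lt_of_leads (heqm : IsEqm H p l u c M F r)
    (hreach : ∀ v : V, Nonempty (H.Walk p v)) (hlu : l < u) (hc : 0 < c) (hcM : c < M)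
    (hFcont : ContinuousOn F (Set.Icc l u)) (hFmono : StrictMonoOn F (Set.Icc l u))
    (hFl : F l = 0) (hFu : F u = 1) {i k : V} (hi : i ∈ agents p) (hk : k ∈ agents p)
    (hik : Leads H p i k) : r i < r k := by
  by_contra! hle
  have hri := heqm.1 i hi
  have hnonneg := heqm.piU_nonneg hlu hcM hFcont hFu hk ⟨hle, hri.2⟩
  have hbd : ∀ x ∈ agents p, F (max (r x) (r i)) ∈ Set.Icc 0 1 := fun x hx =>
    heqm.map_max_mem_Icc hFmono hlu hFl hFu hx hri
  have hprod : ∏ j ∈ Pset H p k, F (max (r j) (r i)) ≤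
      F (r i) * ∏ j ∈ Pset H p i, F (max (r j) (r i)) := by
    have hnot : i ∉ Pset H p i := fun h => (mem_Pset.1 h).2.1 rfl
    calc _ ≤ ∏ j ∈ insert i (Pset H p i), F (max (r j) (r i)) :=
          prod_le_prod_of_subset_of_le_one (insert_Pset_subset hreach hi hik)
            (fun j hj => (hbd j (mem_Pset.1 hj).1).1)
            (fun j hj _ => (hbd j (mem_Pset.1 hj).1).2)
      _ = _ := by rw [prod_insert hnot, max_self]
  have hlt : F (r i) < 1 := hFu ▸ hFmono hri (Set.right_mem_Icc.2 hlu.le)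
    (heqm.lt_upper hlu hcM hFu hi)
  have hFi : 0 ≤ F (r i) := max_self (r i) ▸ (hbd i hi).1
  have hM := mul_le_mul_of_nonneg_left hprod (hc.trans hcM).le
  rcases heqm.2.2 i hi with h | h
  · rw [piU] at hnonneg
    rw [h, hFl, zero_mul, mul_zero] at hM
    rw [h] at hnonneg
    linarith
  · rw [piU] at hnonneg h
    nlinarith

theorem IsEqm.lower_lt_of_mem_Pset (heqm : IsEqm H p l u c M F r) (hlu : l < u) (hc : 0 < c)
    (hcM : c < M) (hFcont : ContinuousOn F (Set.Icc l u)) (hFl : F l = 0) (hFu : F u = 1)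
    {i j : V} (hi : i ∈ agents p) (hj : j ∈ Pset H p i) (hri : r i = l) : l < r j := by
  refine lt_of_le_of_ne (heqm.1 j (mem_Pset.1 hj).1).1 fun hjl => ?_
  have h := heqm.piU_nonneg hlu hcM hFcont hFu hi (Set.left_mem_Icc.2 (heqm.1 i hi).2)
  rw [piU, prod_eq_zero hj (by rw [hri, ← hjl, max_self, hFl])] at h
  linarith

/-- The total product at the threshold of `i`, when that threshold is interior. -/
theorem IsEqm.mul_prod_agents_eq (heqm : IsEqm H p l u c M F r)
    (hreach : ∀ v : V, Nonempty (H.Walk p v)) (hlu : l < u) (hc : 0 < c) (hcM : c < M)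
    (hFcont : ContinuousOn F (Set.Icc l u)) (hFmono : StrictMonoOn F (Set.Icc l u))
    (hFl : F l = 0) (hFu : F u = 1) {i : V} (hi : i ∈ agents p) (hri : l < r i) :
    M * ∏ k ∈ agents p, F (max (r k) (r i)) = c * (F (r i) * lom H p F r i) := by
  have h₁ := heqm.piU_nonneg hlu hcM hFcont hFu hi (Set.left_mem_Icc.2 (heqm.1 i hi).2)
  have h₂ := (heqm.2.2 i hi).resolve_left hri.ne'
  have heq : M * ∏ k ∈ Pset H p i, F (max (r k) (r i)) = c := by
    rw [piU] at h₁ h₂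
    linarith
  have hlom : ∏ k ∈ Dset H p i, F (max (r k) (r i)) = lom H p F r i :=
    prod_congr rfl fun k hk => by
      obtain ⟨hk, hik⟩ := mem_Dset.1 hk
      rw [max_eq_left
        (heqm.lt_of_leads hreach hlu hc hcM hFcont hFmono hFl hFu hi hk hik).le]
  rw [prod_agents_eq (H := H) _ hi, ← mul_assoc, heq, hlom, max_self]

theorem IsEqm.lom_lt_lom (heqm : IsEqm H p l u c M F r)
    (hreach : ∀ v : V, Nonempty (H.Walk p v)) (hlu : l < u) (hc : 0 < c) (hcM : c < M)
    (hFcont : ContinuousOn F (Set.Icc l u)) (hFmono : StrictMonoOn F (Set.Icc l u))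
    (hFl : F l = 0) (hFu : F u = 1) {i j : V} (hi : i ∈ agents p) (hj : j ∈ agents p)
    (hij : r i < r j) : lom H p F r i < lom H p F r j := by
  have hrj := heqm.1 j hj
  have hl : l < r j := (heqm.1 i hi).1.trans_lt hij
  have hpos : ∀ x ∈ Set.Icc l u, l < x → 0 < F x := fun x hx hlx =>
    hFl ▸ hFmono (Set.left_mem_Icc.2 hlu.le) hx hlx
  have hle : ∀ k ∈ agents p, F (r k) ≤ F (max (r k) (r j)) := fun k hk =>
    hFmono.monotoneOn (heqm.1 k hk) ⟨hrj.1.trans (le_max_right _ _),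
      max_le (heqm.1 k hk).2 hrj.2⟩ (le_max_left _ _)
  have hDpos : ∀ k ∈ Dset H p i, 0 < F (r k) := fun k hk => by
    obtain ⟨hk, hik⟩ := mem_Dset.1 hk
    exact hpos _ (heqm.1 k hk) ((heqm.1 i hi).1.trans_lt
      (heqm.lt_of_leads hreach hlu hc hcM hFcont hFmono hFl hFu hi hk hik))
  have hlom_pos : 0 < lom H p F r i := prod_pos hDpos
  have hlom_le : lom H p F r i ≤ ∏ k ∈ Dset H p i, F (max (r k) (r j)) :=
    prod_le_prod (fun k hk => (hDpos k hk).le) fun k hk => hle k (mem_Dset.1 hk).1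
  have hpi : c < M * ∏ k ∈ Pset H p i, F (max (r k) (r j)) :=
    sub_pos.1 (heqm.2.1 i hi (r j) ⟨hij, hrj.2⟩)
  have htotal := heqm.mul_prod_agents_eq hreach hlu hc hcM hFcont hFmono hFl hFu hj hl
  have hFj : 0 < F (r j) := hpos _ hrj hl
  rw [prod_agents_eq (H := H) _ hi, max_eq_right hij.le] at htotal
  refine lt_of_mul_lt_mul_left (a := c * F (r j)) ?_ (mul_pos hc hFj).le
  calc c * F (r j) * lom H p F r i
      ≤ c * F (r j) * ∏ k ∈ Dset H p i, F (max (r k) (r j)) := by gcongr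
    _ < M * (∏ k ∈ Pset H p i, F (max (r k) (r j))) * F (r j) *
          ∏ k ∈ Dset H p i, F (max (r k) (r j)) := by
        gcongr
        exact hlom_pos.trans_le hlom_le
    _ = c * F (r j) * lom H p F r j := by linarith

theorem IsEqm.lom_eq_lom (heqm : IsEqm H p l u c M F r)
    (hreach : ∀ v : V, Nonempty (H.Walk p v)) (hlu : l < u) (hc : 0 < c) (hcM : c < M)
    (hFcont : ContinuousOn F (Set.Icc l u)) (hFmono : StrictMonoOn F (Set.Icc l u))
    (hFl : F l = 0) (hFu : F u = 1) {i j : V} (hi : i ∈ agents p) (hj : j ∈ agents p)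
    (hne : i ≠ j) (hij : r i = r j) : lom H p F r i = lom H p F r j := by
  have hl : l < r i := by
    refine lt_of_le_of_ne (heqm.1 i hi).1 fun h => ?_
    by_cases hlead : Leads H p i j
    · exact (heqm.lt_of_leads hreach hlu hc hcM hFcont hFmono hFl hFu hi hj hlead).ne hij
    · exact (heqm.lower_lt_of_mem_Pset hlu hc hcM hFcont hFl hFu hi
        (mem_Pset.2 ⟨hj, hne.symm, hlead⟩) h.symm).ne (h.trans hij)
  have htotal_i := heqm.mul_prod_agents_eq hreach hlu hc hcM hFcont hFmono hFl hFu hi hl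
  have htotal_j := heqm.mul_prod_agents_eq hreach hlu hc hcM hFcont hFmono hFl hFu hj
    (hij ▸ hl)
  have hFi : 0 < F (r i) := hFl ▸ hFmono (Set.left_mem_Icc.2 hlu.le) (heqm.1 i hi) hl
  rw [← hij, htotal_i] at htotal_j
  exact mul_left_cancel₀ hFi.ne' (mul_left_cancel₀ hc.ne' htotal_j)

end Equilibrium

/-- Monotonicity of thresholds (Proposition 4): for distinct agents, `r i < r j` iff
`p_i^lom < p_j^lom`, and consequently `r i = r j` iff `p_i^lom = p_j^lom`. -/
theorem threshold_monotonicity {V : Type*} [Fintype V] [DecidableEq V]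
    (H : SimpleGraph V) (p : V) (hreach : ∀ v : V, Nonempty (H.Walk p v))
    (l u c M : ℝ) (hlu : l < u) (hc : 0 < c) (hcM : c < M)
    (F : ℝ → ℝ) (hFcont : ContinuousOn F (Set.Icc l u))
    (hFmono : StrictMonoOn F (Set.Icc l u)) (hFl : F l = 0) (hFu : F u = 1)
    (r : V → ℝ) (heqm : IsEqm H p l u c M F r)
    (i j : V) (hi : i ∈ agents p) (hj : j ∈ agents p) (hij : i ≠ j) :
    (r i < r j ↔ lom H p F r i < lom H p F r j) ∧
    (r i = r j ↔ lom H p F r i = lom H p F r j) := by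
  have hlt := heqm.lom_lt_lom hreach hlu hc hcM hFcont hFmono hFl hFu hi hj
  have hgt := heqm.lom_lt_lom hreach hlu hc hcM hFcont hFmono hFl hFu hj hi
  have heq := heqm.lom_eq_lom hreach hlu hc hcM hFcont hFmono hFl hFu hi hj hij
  rcases lt_trichotomy (r i) (r j) with h | h | h
  · simp [h, hlt h, h.ne, (hlt h).ne]
  · simp [h, heq h]
  · simp [h.not_gt, (hgt h).not_gt, h.ne', (hgt h).ne']
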